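/- arXiv:2604.15980 — 2 statements merged into one kernel-verified Lean document; each statement's English description precedes it below -/
import Mathlib

section
/- Let (X, 𝓑, μ) be a probability space and let f, g : X → ℝ be bounded measurable functions with f ≥ 0, ∫ f dμ = 1, ∫ g dμ = 1, and g ≥ 1/2 μ-almost everywhere. Then the Kullback–Leibler divergence satisfies KL(f·μ ‖ g·μ) ≤ 2·∫ (f − g)² dμ. -/
open MeasureTheory

/-- The integrand of the Kullback–Leibler divergence is bounded by the integrand of the
`χ²`-divergence, up to a term that integrates to zero for probability densities. -/
lemma mul_log_div_le_sq_sub_div_add {a b : ℝ} (ha : 0 ≤ a) (hb : 0 < b) :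
    a * Real.log (a / b) ≤ (a - b) ^ 2 / b + (a - b) := by
  rcases ha.eq_or_lt with rfl | ha'
  · simp [pow_two, hb.ne']
  · calc a * Real.log (a / b) ≤ a * (a / b - 1) :=
          mul_le_mul_of_nonneg_left (Real.log_le_sub_one_of_pos (div_pos ha' hb)) ha
      _ = (a - b) ^ 2 / b + (a - b) := by field_simp; ring

/-- If `f, g` are bounded measurable densities on a probability space `(X, μ)` with `f ≥ 0`,
`∫ f dμ = ∫ g dμ = 1` and `g ≥ 1/2` a.e., then the Kullback–Leibler divergence
`KL(f·μ ‖ g·μ) = ∫ f log(f/g) dμ` is at most `2 ∫ (f − g)² dμ`. -/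
theorem stmt9 {X : Type*} [MeasurableSpace X] (μ : Measure X) [IsProbabilityMeasure μ]
    (f g : X → ℝ) (hfmeas : Measurable f) (hgmeas : Measurable g)
    (hfbdd : ∃ B : ℝ, ∀ p, |f p| ≤ B) (hgbdd : ∃ B : ℝ, ∀ p, |g p| ≤ B)
    (hf0 : ∀ p, 0 ≤ f p) (hf1 : (∫ p, f p ∂μ) = 1) (hg1 : (∫ p, g p ∂μ) = 1)
    (hg : ∀ᵐ p ∂μ, 1 / 2 ≤ g p) :
    (∫ p, f p * Real.log (f p / g p) ∂μ) ≤ 2 * ∫ p, (f p - g p) ^ 2 ∂μ := by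
  have hf_int : Integrable f μ := by
    obtain ⟨B, hB⟩ := hfbdd
    exact Integrable.of_bound hfmeas.aestronglyMeasurable B (ae_of_all _ hB)
  have hg_int : Integrable g μ := by
    obtain ⟨B, hB⟩ := hgbdd
    exact Integrable.of_bound hgmeas.aestronglyMeasurable B (ae_of_all _ hB)
  have hsq_int : Integrable (fun p ↦ (f p - g p) ^ 2) μ := by
    obtain ⟨B, hB⟩ := hfbdd
    obtain ⟨C, hC⟩ := hgbdd
    refine Integrable.of_bound ((hfmeas.sub hgmeas).pow_const 2).aestronglyMeasurable
      ((B + C) ^ 2) (ae_of_all _ fun p ↦ ?_)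
    rw [norm_pow, Real.norm_eq_abs]
    exact pow_le_pow_left₀ (abs_nonneg _)
      ((abs_sub _ _).trans (add_le_add (hB p) (hC p))) 2
  have hsub_int : Integrable (fun p ↦ f p - g p) μ := hf_int.sub hg_int
  by_cases hkl_int : Integrable (fun p ↦ f p * Real.log (f p / g p)) μ
  · calc (∫ p, f p * Real.log (f p / g p) ∂μ)
        ≤ ∫ p, (2 * (f p - g p) ^ 2 + (f p - g p)) ∂μ := by
          refine integral_mono_ae hkl_int ((hsq_int.const_mul 2).add hsub_int) ?_
          filter_upwards [hg] with p hp
          have hpos : 0 < g p := by linarith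
          refine (mul_log_div_le_sq_sub_div_add (hf0 p) hpos).trans ?_
          gcongr
          rw [div_le_iff₀ hpos]
          nlinarith [sq_nonneg (f p - g p)]
      _ = 2 * ∫ p, (f p - g p) ^ 2 ∂μ := by
          rw [integral_add (hsq_int.const_mul 2) hsub_int, integral_const_mul,
            integral_sub hf_int hg_int, hf1, hg1, sub_self, add_zero]
  · rw [integral_undef hkl_int]
    exact mul_nonneg zero_le_two (integral_nonneg fun p ↦ sq_nonneg _)
end

section
/- Let H be a finite set with |H| ≥ 2, let (Y, 𝓨) be a measurable space, and let (P_α)_{α∈H} be a family of probability measures on Y that are pairwise mutually absolutely continuous with K := max_{α≠β} KL(P_α ‖ P_β) < ∞. Then for every measurable map α̂ : Y → H: (1/|H|)·Σ_{α∈H} P_α(α̂ ≠ α) ≥ 1 − (K + log 2)/log|H|. -/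
open MeasureTheory

/-- The Donsker–Varadhan lower bound on the Kullback–Leibler divergence, linearized and
specialized to a two-valued test function. -/
theorem measureReal_mul_log_le_integral_llr {Y : Type*} [MeasurableSpace Y] (P Q : Measure Y)
    [IsProbabilityMeasure P] [IsProbabilityMeasure Q] (hPQ : P ≪ Q) (hQP : Q ≪ P)
    (hint : Integrable (llr P Q) P) {A : Set Y} (hA : MeasurableSet A) {N : ℝ} (hN : 0 < N) :
    P.real A * Real.log N + 1 / 2 - Real.log 2 ≤
      (∫ y, llr P Q y ∂P) + (N - 1) / 2 * Q.real A := by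
  set g : Y → ℝ := fun y => (Q.rnDeriv P y).toReal with hg
  have hgi : Integrable g P := Measure.integrable_toReal_rnDeriv
  have hg1 : ∫ y, g y ∂P = 1 := by
    simpa using Measure.integral_toReal_rnDeriv hQP
  have hgA : ∫ y, A.indicator g y ∂P = Q.real A := by
    rw [integral_indicator hA]
    exact Measure.setIntegral_toReal_rnDeriv hQP A
  have hiA : Integrable (A.indicator fun _ => Real.log N) P :=
    (integrable_const _).indicator hA
  have hpt : ∀ᵐ y ∂P, A.indicator (fun _ => Real.log N) y + (1 - Real.log 2) ≤
      llr P Q y + (1 / 2 * g y + (N - 1) / 2 * A.indicator g y) := by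
    filter_upwards [exp_neg_llr hPQ] with y hy
    have hgy : Real.exp (-llr P Q y) = g y := hy
    by_cases hyA : y ∈ A
    · have h := Real.add_one_le_exp (Real.log N - Real.log 2 + -llr P Q y)
      rw [Real.exp_add, Real.exp_sub, Real.exp_log hN, Real.exp_log two_pos, hgy] at h
      simp only [Set.indicator_of_mem hyA]
      linarith
    · have h := Real.add_one_le_exp (-Real.log 2 + -llr P Q y)
      rw [Real.exp_add, Real.exp_neg, Real.exp_log two_pos, hgy] at h
      simp only [Set.indicator_of_notMem hyA]
      linarith
  have hiR : Integrable (fun y => 1 / 2 * g y + (N - 1) / 2 * A.indicator g y) P :=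
    (hgi.const_mul _).add ((hgi.indicator hA).const_mul _)
  have h := integral_mono_ae (hiA.add (integrable_const (1 - Real.log 2))) (hint.add hiR) hpt
  simp only [Pi.add_apply] at h
  rw [integral_add hiA (integrable_const _), integral_add hint hiR,
    integral_add (hgi.const_mul _) ((hgi.indicator hA).const_mul _), integral_const_mul,
    integral_const_mul, hg1, hgA, integral_indicator_const _ hA] at h
  simp only [smul_eq_mul, integral_const, probReal_univ] at h
  linarith

/-- Fano-type inequality: let `H` be a finite set with `|H| ≥ 2` and `(P α)_{α ∈ H}` a family
of pairwise mutually absolutely continuous probability measures on `Y` whose pairwise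
Kullback–Leibler divergences `KL(P α ‖ P β) = ∫ llr (P α) (P β) dP α` are finite and bounded
by `K`.  Then every measurable classifier `αhat : Y → H` satisfies
`(1/|H|) Σ_α P α (αhat ≠ α) ≥ 1 − (K + log 2)/log |H|`. -/
theorem stmt12 {H : Type*} [Fintype H] (hH : 2 ≤ Fintype.card H)
    {Y : Type*} [MeasurableSpace Y]
    (P : H → Measure Y) [∀ α, IsProbabilityMeasure (P α)]
    (habs : ∀ α β, P α ≪ P β)
    (hint : ∀ α β, Integrable (llr (P α) (P β)) (P α))
    (K : ℝ) (hK : ∀ α β, α ≠ β → (∫ y, llr (P α) (P β) y ∂(P α)) ≤ K)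
    (αhat : Y → H) (hαhat : ∀ α, MeasurableSet {y | αhat y = α}) :
    1 - (K + Real.log 2) / Real.log (Fintype.card H) ≤
      (1 / (Fintype.card H : ℝ)) * ∑ α : H, ((P α) {y | αhat y ≠ α}).toReal := by
  set N : ℝ := (Fintype.card H : ℝ) with hNdef
  have hN2 : (2 : ℝ) ≤ N := hNdef ▸ by exact_mod_cast hH
  have hN0 : 0 < N := by linarith
  have hlog : 0 < Real.log N := Real.log_pos (by linarith)
  have hK0 : 0 ≤ K := by
    have : Nontrivial H := Fintype.one_lt_card_iff_nontrivial.mp hH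
    obtain ⟨α, β, hne⟩ := exists_pair_ne H
    have h := InformationTheory.integral_llr_add_sub_measure_univ_nonneg (habs α β) (hint α β)
    simp only [probReal_univ] at h
    linarith [hK α β hne]
  have hK' : ∀ α β, (∫ y, llr (P α) (P β) y ∂(P α)) ≤ K := by
    intro α β
    by_cases hne : α = β
    · subst hne
      rw [integral_congr_ae (llr_self (P α))]
      simpa using hK0
    · exact hK α β hne
  have hpair : ∀ α β, (P α).real {y | αhat y = α} * Real.log N + (1 / 2 - Real.log 2 - K) ≤
      (N - 1) / 2 * (P β).real {y | αhat y = α} := fun α β => by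
    linarith [measureReal_mul_log_le_integral_llr (P α) (P β) (habs α β) (habs β α) (hint α β)
      (hαhat α) hN0, hK' α β]
  have hone : ∀ β, ∑ α, (P β).real {y | αhat y = α} = 1 := by
    intro β
    rw [← measureReal_iUnion_fintype _ hαhat, ← probReal_univ (μ := P β)]
    · congr 1
      ext y
      simp
    · intro a b hab
      exact Set.disjoint_left.mpr fun y ha hb => hab (ha.symm.trans hb)
  have hcompl : ∀ α, ((P α) {y | αhat y ≠ α}).toReal = 1 - (P α).real {y | αhat y = α} :=
    fun α => probReal_compl_eq_one_sub (hαhat α)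
  set S := ∑ α, (P α).real {y | αhat y = α} with hS
  have hsum : N * (S * Real.log N + N * (1 / 2 - Real.log 2 - K)) ≤ N * ((N - 1) / 2) := by
    have h := Finset.sum_le_sum fun β (_ : β ∈ Finset.univ) =>
      Finset.sum_le_sum fun α (_ : α ∈ Finset.univ) => hpair α β
    simp only [Finset.sum_add_distrib, ← Finset.sum_mul, ← Finset.mul_sum, hone,
      Finset.sum_const, Finset.card_univ, nsmul_eq_mul, mul_one, ← hS, ← hNdef] at h
    linarith
  have hS' : S * Real.log N ≤ N * (K + Real.log 2) := by
    linarith [le_of_mul_le_mul_left hsum hN0]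
  have hdiv : S / N ≤ (K + Real.log 2) / Real.log N := by
    rw [div_le_div_iff₀ hN0 hlog]
    linarith
  have hgoal : 1 / N * ∑ α, ((P α) {y | αhat y ≠ α}).toReal = 1 - S / N := by
    simp only [hcompl, Finset.sum_sub_distrib, Finset.sum_const, Finset.card_univ, nsmul_eq_mul,
      mul_one, ← hS, ← hNdef]
    field_simp
  linarith
end
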